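/- For every irrational α and every ξ ∈ (0,1), there exists f ∈ C₀^ξ(𝕋) such that no g with ‖g − f‖_ξ < 0.1 is a continuous coboundary for the rotation R_α; i.e., there is no continuous u : 𝕋 → ℝ with zero mean satisfying g = u ∘ R_α − u. In particular, continuous coboundaries are not dense in (C₀^ξ(𝕋), ‖·‖_ξ). -/

import Mathlib

open MeasureTheory
open scoped NNReal

namespace Stmt18Aux

lemma approx (α : ℝ) (M : ℕ) (hM : 0 < M) :
    ∃ q : ℕ, M ≤ q ∧ ∃ p : ℤ, |(q : ℝ) * α - p| ≤ 1 / q := by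
  have hn : 0 < M ^ 3 := by positivity
  obtain ⟨j, k, hk0, hkn, h⟩ := Real.exists_int_int_abs_mul_sub_le α hn
  lift k to ℕ using hk0.le
  have hk0' : 0 < k := by exact_mod_cast hk0
  have hkn' : k ≤ M ^ 3 := by exact_mod_cast hkn
  have hkR : (0 : ℝ) < k := by exact_mod_cast hk0'
  have hMR : (0 : ℝ) < M := by exact_mod_cast hM
  push_cast at h
  by_cases hkM : M ≤ k
  · refine ⟨k, hkM, j, h.trans ?_⟩
    apply one_div_le_one_div_of_le hkR
    have : (k : ℝ) ≤ (M : ℝ) ^ 3 := by exact_mod_cast hkn'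
    linarith
  · push Not at hkM
    have hkM' : (k : ℝ) ≤ M := by exact_mod_cast hkM.le
    refine ⟨M * k, Nat.le_mul_of_pos_right _ hk0', M * j, ?_⟩
    push_cast
    have e : (M : ℝ) * k * α - M * j = M * (k * α - j) := by ring
    rw [e, abs_mul, abs_of_pos hMR]
    calc (M : ℝ) * |k * α - j| ≤ M * (1 / ((M : ℝ) ^ 3 + 1)) := by gcongr
      _ ≤ 1 / (M * k) := by
        rw [mul_one_div, div_le_div_iff₀ (by positivity) (by positivity)]
        have : (M : ℝ) * (M * k) ≤ M * (M * M) := by gcongr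
        nlinarith

/-- cosine of frequency q on the circle -/
noncomputable def c (q : ℕ) : UnitAddCircle → ℝ :=
  Function.Periodic.lift (f := fun x : ℝ => Real.cos (2 * Real.pi * q * x)) (c := (1 : ℝ)) (by
    intro x
    have : 2 * Real.pi * q * (x + 1) = 2 * Real.pi * q * x + q * (2 * Real.pi) := by ring
    simp only [this, Real.cos_add_nat_mul_two_pi])

lemma c_coe (q : ℕ) (x : ℝ) : c q (x : UnitAddCircle) = Real.cos (2 * Real.pi * q * x) := rfl

lemma c_abs (q : ℕ) (x : UnitAddCircle) : |c q x| ≤ 1 := by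
  induction x using QuotientAddGroup.induction_on with
  | H x => exact Real.abs_cos_le_one _

lemma cos_lip (a b : ℝ) : |Real.cos a - Real.cos b| ≤ |a - b| := by
  have h := Real.lipschitzWith_cos.dist_le_mul a b
  simpa [Real.dist_eq] using h

lemma c_lip (q : ℕ) (x y : UnitAddCircle) : |c q x - c q y| ≤ 2 * Real.pi * q * dist x y := by
  induction x using QuotientAddGroup.induction_on with
  | H x =>
  induction y using QuotientAddGroup.induction_on with
  | H y =>
  have hd : dist (x : UnitAddCircle) (y : UnitAddCircle) = |x - y - round (x - y)| := by
    rw [dist_eq_norm, ← UnitAddCircle.norm_eq]; rfl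
  have e : Real.cos (2 * Real.pi * q * y)
      = Real.cos (2 * Real.pi * q * (y + round (x - y))) := by
    have : 2 * Real.pi * q * (y + round (x - y))
      = 2 * Real.pi * q * y + ((q * round (x - y) : ℤ) : ℝ) * (2 * Real.pi) := by
        push_cast; ring
    rw [this, Real.cos_add_int_mul_two_pi]
  change |Real.cos (2 * Real.pi * q * x) - Real.cos (2 * Real.pi * q * y)|
    ≤ 2 * Real.pi * q * dist (x : UnitAddCircle) (y : UnitAddCircle)
  rw [hd, e]
  refine (cos_lip _ _).trans (le_of_eq ?_)
  rw [← mul_sub, abs_mul, abs_of_nonneg (by positivity)]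
  congr 2
  ring

/-- data -/
structure Data (α ξ : ℝ) (Q : ℕ → ℕ) : Prop where
  pos : ∀ n, 0 < Q n
  app : ∀ n, ∃ p : ℤ, |(Q n : ℝ) * α - p| ≤ 1 / Q n
  ha : ∀ n, (Q (n+1) : ℝ) ^ (-ξ) ≤ (Q n : ℝ) ^ (-ξ) / 100
  hb : ∀ n, 100 * (Q n : ℝ) ^ (1-ξ) ≤ (Q (n+1) : ℝ) ^ (1-ξ)

lemma exists_K (s : ℝ) (hs : 0 < s) : ∀ᶠ K : ℕ in Filter.atTop, (100 : ℝ) ≤ (K : ℝ) ^ s :=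
  ((tendsto_rpow_atTop hs).comp tendsto_natCast_atTop_atTop).eventually_ge_atTop 100

lemma exists_data (α ξ : ℝ) (h0 : 0 < ξ) (h1 : ξ < 1) : ∃ Q, Data α ξ Q := by
  obtain ⟨K, hK1, hK2, hK⟩ := ((exists_K ξ h0).and
    ((exists_K (1-ξ) (by linarith)).and (Filter.eventually_gt_atTop 0))).exists
  have hex : ∀ M : ℕ, ∃ q : ℕ, 0 < q ∧ M ≤ q ∧ ∃ p : ℤ, |(q : ℝ) * α - p| ≤ 1 / q := by
    intro M
    obtain ⟨q, hq, h⟩ := approx α (M+1) (by omega)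
    exact ⟨q, by omega, by omega, h⟩
  choose pick hp1 hp2 hp3 using hex
  obtain ⟨Q, hQ0, hQs⟩ : ∃ Q : ℕ → ℕ, Q 0 = pick 1 ∧ ∀ n, Q (n+1) = pick (K * Q n) :=
    ⟨fun n => Nat.rec (pick 1) (fun _ r => pick (K * r)) n, rfl, fun _ => rfl⟩
  have hpos : ∀ n, 0 < Q n := by
    intro n
    cases n with
    | zero => rw [hQ0]; exact hp1 1
    | succ n => rw [hQs]; exact hp1 _
  have hle : ∀ n : ℕ, (K : ℝ) * ((Q n : ℕ) : ℝ) ≤ ((Q (n+1) : ℕ) : ℝ) := by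
    intro n
    have h : K * Q n ≤ Q (n+1) := by rw [hQs]; exact hp2 _
    exact_mod_cast h
  refine ⟨Q, hpos, ?_, ?_, ?_⟩
  · intro n
    cases n with
    | zero => rw [hQ0]; exact hp3 1
    | succ n => rw [hQs]; exact hp3 _
  · intro n
    have hq : (0 : ℝ) < Q n := by exact_mod_cast hpos n
    have hK' : (0 : ℝ) < K := by exact_mod_cast hK
    calc (Q (n+1) : ℝ) ^ (-ξ) ≤ (K * Q n : ℝ) ^ (-ξ) :=
          Real.rpow_le_rpow_of_nonpos (by positivity) (hle n) (by linarith)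
      _ = (Q n : ℝ) ^ (-ξ) / (K : ℝ) ^ ξ := by
          rw [Real.mul_rpow hK'.le hq.le, Real.rpow_neg hK'.le]; field_simp
      _ ≤ _ := by gcongr
  · intro n
    have hq : (0 : ℝ) < Q n := by exact_mod_cast hpos n
    have hK' : (0 : ℝ) < K := by exact_mod_cast hK
    calc 100 * (Q n : ℝ) ^ (1-ξ) ≤ (K : ℝ) ^ (1-ξ) * (Q n : ℝ) ^ (1-ξ) := by gcongr
      _ = (K * Q n : ℝ) ^ (1-ξ) := by rw [Real.mul_rpow hK'.le hq.le]
      _ ≤ _ := Real.rpow_le_rpow (by positivity) (hle n) (by linarith)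

section
variable {α ξ : ℝ} {Q : ℕ → ℕ}

lemma a_geom (D : Data α ξ Q) (n i : ℕ) :
    (Q (n+i) : ℝ) ^ (-ξ) ≤ (Q n : ℝ) ^ (-ξ) * (1/100 : ℝ) ^ i := by
  induction i with
  | zero => simp
  | succ i ih =>
    have := D.ha (n+i)
    rw [pow_succ, ← add_assoc]
    linarith

lemma b_grow (D : Data α ξ Q) (n : ℕ) :
    (100 : ℝ) ^ n * (Q 0 : ℝ) ^ (1-ξ) ≤ (Q n : ℝ) ^ (1-ξ) := by
  induction n with
  | zero => simp
  | succ i ih =>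
    have := D.hb i
    rw [pow_succ]
    linarith

lemma b_tendsto (D : Data α ξ Q) :
    Filter.Tendsto (fun n => (Q n : ℝ) ^ (1-ξ)) Filter.atTop Filter.atTop := by
  have hp : 0 < (Q 0 : ℝ) ^ (1-ξ) := Real.rpow_pos_of_pos (by exact_mod_cast D.pos 0) _
  refine Filter.tendsto_atTop_mono (b_grow D) ?_
  exact (tendsto_pow_atTop_atTop_of_one_lt (by norm_num)).atTop_mul_const hp

lemma b_sum (D : Data α ξ Q) (n : ℕ) :
    ∑ j ∈ Finset.range n, (Q j : ℝ) ^ (1-ξ) ≤ (Q n : ℝ) ^ (1-ξ) / 99 := by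
  induction n with
  | zero => simp; positivity
  | succ i ih =>
    have := D.hb i
    rw [Finset.sum_range_succ]
    linarith

lemma a_summable (D : Data α ξ Q) (n : ℕ) : Summable (fun i => (Q (n+i) : ℝ) ^ (-ξ)) :=
  Summable.of_nonneg_of_le (fun i => by positivity) (a_geom D n)
    ((summable_geometric_of_lt_one (by norm_num) (by norm_num)).mul_left _)

/-- the function -/
noncomputable def F (ξ : ℝ) (Q : ℕ → ℕ) (x : UnitAddCircle) : ℝ :=
  ∑' j, (Q j : ℝ) ^ (-ξ) * c (Q j) x

lemma F_summable (D : Data α ξ Q) (x : UnitAddCircle) :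
    Summable (fun j => (Q j : ℝ) ^ (-ξ) * c (Q j) x) := by
  have h := a_summable D 0
  simp only [zero_add] at h
  refine Summable.of_norm_bounded h ?_
  intro i
  rw [Real.norm_eq_abs, abs_mul, abs_of_nonneg (by positivity)]
  exact mul_le_of_le_one_right (by positivity) (c_abs _ _)

lemma tail (D : Data α ξ Q) (n : ℕ) (x y : UnitAddCircle) :
    |F ξ Q x - F ξ Q y
      - ∑ j ∈ Finset.range n, (Q j : ℝ) ^ (-ξ) * (c (Q j) x - c (Q j) y)|
      ≤ 2.1 * (Q n : ℝ) ^ (-ξ) := by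
  set t : ℕ → ℝ := fun j => (Q j : ℝ) ^ (-ξ) * (c (Q j) x - c (Q j) y) with ht
  have hsum : Summable t := by
    have := (F_summable D x).sub (F_summable D y)
    simpa [ht, mul_sub] using this
  have hF : F ξ Q x - F ξ Q y = ∑' j, t j := by
    unfold F
    rw [← (F_summable D x).tsum_sub (F_summable D y)]
    simp [ht, mul_sub]
  rw [hF, ← hsum.sum_add_tsum_nat_add n, add_sub_cancel_left]
  have hg : HasSum (fun i : ℕ => (2 * (Q n : ℝ) ^ (-ξ)) * (1/100 : ℝ) ^ i)
      ((2 * (Q n : ℝ) ^ (-ξ)) * (1 - 1/100)⁻¹) :=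
    (hasSum_geometric_of_lt_one (by norm_num) (by norm_num)).mul_left _
  have hb := tsum_of_norm_bounded (f := fun i => t (i + n)) hg (by
    intro i
    have h1 : |c (Q (i+n)) x - c (Q (i+n)) y| ≤ 2 := by
      have := abs_sub (c (Q (i+n)) x) (c (Q (i+n)) y)
      have := c_abs (Q (i+n)) x
      have := c_abs (Q (i+n)) y
      linarith
    have h2 := a_geom D n i
    rw [add_comm n i] at h2
    simp only [ht]
    rw [Real.norm_eq_abs, abs_mul, abs_of_nonneg (by positivity)]
    calc _ ≤ ((Q n : ℝ) ^ (-ξ) * (1/100 : ℝ) ^ i) * 2 := by gcongr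
      _ = _ := by ring)
  rw [Real.norm_eq_abs] at hb
  refine hb.trans ?_
  have : 0 ≤ (Q n : ℝ) ^ (-ξ) := by positivity
  norm_num
  linarith

lemma head (D : Data α ξ Q) (n : ℕ) (x y : UnitAddCircle) :
    |∑ j ∈ Finset.range n, (Q j : ℝ) ^ (-ξ) * (c (Q j) x - c (Q j) y)|
      ≤ 2 * Real.pi * dist x y * ((Q n : ℝ) ^ (1-ξ) / 99) := by
  refine (Finset.abs_sum_le_sum_abs _ _).trans ?_
  refine le_trans ?_ (mul_le_mul_of_nonneg_left (b_sum D n) (by positivity))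
  rw [Finset.mul_sum]
  refine Finset.sum_le_sum fun j _ => ?_
  have hq : (0 : ℝ) < Q j := by exact_mod_cast D.pos j
  rw [abs_mul, abs_of_nonneg (by positivity)]
  calc _ ≤ (Q j : ℝ) ^ (-ξ) * (2 * Real.pi * Q j * dist x y) := by
        gcongr; exact c_lip _ _ _
    _ = _ := by
        rw [sub_eq_add_neg, Real.rpow_add hq, Real.rpow_one]; ring

lemma head' (D : Data α ξ Q) (n : ℕ) (x y : UnitAddCircle) :
    |∑ j ∈ Finset.range (n+1), (Q j : ℝ) ^ (-ξ) * (c (Q j) x - c (Q j) y)|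
      ≤ 2 * Real.pi * dist x y * (2 * (Q n : ℝ) ^ (1-ξ)) := by
  have hq : (0 : ℝ) < Q n := by exact_mod_cast D.pos n
  have hb : 0 ≤ (Q n : ℝ) ^ (1-ξ) := by positivity
  rw [Finset.sum_range_succ]
  refine (abs_add_le _ _).trans ?_
  have h1 := head D n x y
  have h2 : |(Q n : ℝ) ^ (-ξ) * (c (Q n) x - c (Q n) y)|
      ≤ 2 * Real.pi * dist x y * (Q n : ℝ) ^ (1-ξ) := by
    rw [abs_mul, abs_of_nonneg (by positivity)]
    calc _ ≤ (Q n : ℝ) ^ (-ξ) * (2 * Real.pi * Q n * dist x y) := by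
          gcongr; exact c_lip _ _ _
      _ = _ := by
          rw [sub_eq_add_neg, Real.rpow_add hq, Real.rpow_one]; ring
  have h3 : 0 ≤ 2 * Real.pi * dist x y * (Q n : ℝ) ^ (1-ξ) := by positivity
  linarith

lemma Q_large (D : Data α ξ Q) (h0 : 0 < ξ) (h1 : ξ < 1) (B : ℝ) : ∃ n, B < Q n := by
  obtain ⟨n, hn⟩ := ((b_tendsto D).eventually_gt_atTop (max B 1)).exists
  refine ⟨n, (le_max_left _ _).trans_lt (hn.trans_le ?_)⟩
  have hq : (1 : ℝ) ≤ Q n := by exact_mod_cast D.pos n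
  calc (Q n : ℝ) ^ (1-ξ) ≤ (Q n : ℝ) ^ (1 : ℝ) :=
        Real.rpow_le_rpow_of_exponent_le hq (by linarith)
    _ = _ := Real.rpow_one _

lemma F_holder (D : Data α ξ Q) (h0 : 0 < ξ) (h1 : ξ < 1) (x y : UnitAddCircle) :
    |F ξ Q x - F ξ Q y| ≤ 20 * dist x y ^ ξ := by
  rcases (dist_nonneg (x := x) (y := y)).eq_or_lt with hd | hd
  · have : x = y := dist_eq_zero.mp hd.symm
    subst this
    simp; positivity
  set d := dist x y with hdd
  have hdξ : 0 < d ^ ξ := Real.rpow_pos_of_pos hd _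
  have hex := Q_large D h0 h1 (1/d)
  classical
  set n := Nat.find hex with hn
  have hn1 : 1/d < Q n := Nat.find_spec hex
  have hlow : |∑ j ∈ Finset.range n, (Q j : ℝ) ^ (-ξ) * (c (Q j) x - c (Q j) y)|
      ≤ 4 * Real.pi * d ^ ξ := by
    rcases hm : n with _ | m
    · simp; positivity
    · have hm' : (Q m : ℝ) ≤ 1/d := by
        have := Nat.find_min hex (m := m) (by omega)
        linarith
      refine (head' D m x y).trans ?_
      rw [← hdd]
      have : d * (Q m : ℝ) ^ (1-ξ) ≤ d ^ ξ := by
        calc d * (Q m : ℝ) ^ (1-ξ) ≤ d * (1/d) ^ (1-ξ) := by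
              gcongr
          _ = d ^ ξ := by
              rw [one_div, Real.inv_rpow hd.le, ← Real.rpow_neg hd.le]
              nth_rewrite 1 [← Real.rpow_one d]
              rw [← Real.rpow_add hd]; congr 1; ring
      nlinarith [Real.pi_pos]
  have hhigh : (Q n : ℝ) ^ (-ξ) ≤ d ^ ξ := by
    calc (Q n : ℝ) ^ (-ξ) ≤ (1/d) ^ (-ξ) :=
          Real.rpow_le_rpow_of_nonpos (by positivity) hn1.le (by linarith)
      _ = d ^ ξ := by
          rw [one_div, Real.inv_rpow hd.le, Real.rpow_neg hd.le, inv_inv]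
  have ht := tail D n x y
  have h3 := abs_sub_abs_le_abs_sub (F ξ Q x - F ξ Q y)
    (∑ j ∈ Finset.range n, (Q j : ℝ) ^ (-ξ) * (c (Q j) x - c (Q j) y))
  have := Real.pi_lt_d2
  nlinarith

lemma F_diff (D : Data α ξ Q) (n k : ℕ) (hk : (k : ℝ) ≤ Q n / 6) :
    0.9 * (Q n : ℝ) ^ (-ξ) ≤
      F ξ Q ((k * α : ℝ) : UnitAddCircle)
        - F ξ Q ((k * α + 1 / (2 * Q n) : ℝ) : UnitAddCircle) := by
  have hq : (0 : ℝ) < Q n := by exact_mod_cast D.pos n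
  have ha : 0 < (Q n : ℝ) ^ (-ξ) := Real.rpow_pos_of_pos hq _
  have hpi := Real.pi_pos
  have hpi2 := Real.pi_lt_d2
  have hdist : dist ((k * α : ℝ) : UnitAddCircle)
      ((k * α + 1 / (2 * Q n) : ℝ) : UnitAddCircle) ≤ 1 / (2 * Q n) := by
    rw [dist_comm, dist_eq_norm, ← AddCircle.coe_sub, add_sub_cancel_left]
    refine (UnitAddCircle.norm_eq).trans_le ?_
    refine (round_le _ 0).trans (le_of_eq ?_)
    simp
  set x := ((k * α : ℝ) : UnitAddCircle) with hx
  set y := ((k * α + 1 / (2 * Q n) : ℝ) : UnitAddCircle) with hy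
  have h1 := tail D (n+1) x y
  have h2 := head D n x y
  rw [Finset.sum_range_succ] at h1
  have h3 : 1 ≤ c (Q n) x - c (Q n) y := by
    obtain ⟨p, hp⟩ := D.app n
    have e1 : c (Q n) x = Real.cos (2 * Real.pi * (k * (Q n * α - p))) := by
      rw [hx, c_coe, ← Real.cos_sub_int_mul_two_pi _ (k * p)]
      congr 1; push_cast; ring
    have e2 : c (Q n) y = - c (Q n) x := by
      rw [hx, hy, c_coe, c_coe, ← Real.cos_add_pi]
      congr 1; field_simp
    have hs : |2 * Real.pi * (k * (Q n * α - p))| ≤ Real.pi / 3 := by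
      rw [abs_mul, abs_of_pos (by positivity : (0:ℝ) < 2 * Real.pi), abs_mul, Nat.abs_cast]
      have : (k : ℝ) * |Q n * α - p| ≤ Q n / 6 * (1 / Q n) := by gcongr
      have e : (Q n : ℝ) / 6 * (1 / Q n) = 1/6 := by field_simp
      rw [e] at this
      nlinarith
    have h4 : 1/2 ≤ c (Q n) x := by
      rw [e1, ← Real.cos_abs, ← Real.cos_pi_div_three]
      exact Real.cos_le_cos_of_nonneg_of_le_pi (abs_nonneg _) (by linarith) hs
    linarith
  have h4 : (Q n : ℝ) ^ (-ξ) ≤ (Q n : ℝ) ^ (-ξ) * (c (Q n) x - c (Q n) y) :=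
    le_mul_of_one_le_right ha.le h3
  have h5 : 2 * Real.pi * dist x y * ((Q n : ℝ) ^ (1-ξ) / 99) ≤ 0.04 * (Q n : ℝ) ^ (-ξ) := by
    calc _ ≤ 2 * Real.pi * (1 / (2 * Q n)) * ((Q n : ℝ) ^ (1-ξ) / 99) := by gcongr
      _ = Real.pi / 99 * (Q n : ℝ) ^ (-ξ) := by
          rw [sub_eq_add_neg, Real.rpow_add hq, Real.rpow_one]; field_simp
      _ ≤ _ := by gcongr; linarith
  have h6 := D.ha n
  have h7 := (abs_le.mp h1).1
  have h8 := (abs_le.mp (h2.trans h5)).1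
  linarith

end

end Stmt18Aux

open Stmt18Aux in
theorem stmt18 (α : ℝ) (hα : Irrational α) (ξ : ℝ≥0) (hξ0 : 0 < ξ) (hξ1 : (ξ : ℝ) < 1) :
    ∃ f : UnitAddCircle → ℝ, Continuous f ∧ (∫ x, f x = 0) ∧
      (∃ C : ℝ≥0, HolderWith C ξ f) ∧
      ∀ g : UnitAddCircle → ℝ,
        (∃ c₁ c₂ : ℝ≥0, (c₁ : ℝ) + c₂ < 0.1 ∧ (∀ x, |g x - f x| ≤ c₁) ∧
          HolderWith c₂ ξ (g - f)) →
        ¬ ∃ u : C(UnitAddCircle, ℝ), (∫ x, u x = 0) ∧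
            ∀ x, g x = u (x + ((α : ℝ) : UnitAddCircle)) - u x := by
  have h0 : (0 : ℝ) < ξ := by exact_mod_cast hξ0
  obtain ⟨Q, D⟩ := exists_data α ξ h0 hξ1
  have hH : HolderWith 20 ξ (fun x => F ξ Q x - ∫ y, F ξ Q y) := by
    intro x y
    rw [edist_dist, edist_dist, Real.dist_eq, sub_sub_sub_cancel_right,
      ENNReal.ofReal_rpow_of_nonneg dist_nonneg h0.le]
    have e : ((20 : ℝ≥0) : ENNReal) = ENNReal.ofReal 20 := by simp
    rw [e, ← ENNReal.ofReal_mul (by norm_num)]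
    exact ENNReal.ofReal_le_ofReal (F_holder D h0 hξ1 x y)
  have hc := hH.continuous hξ0
  have hcF : Continuous (F ξ Q) := by
    have := hc.add (continuous_const (y := ∫ y, F ξ Q y))
    refine this.congr fun x => ?_
    simp
  have hint : Integrable (F ξ Q) :=
    hcF.integrable_of_hasCompactSupport (HasCompactSupport.of_compactSpace _)
  refine ⟨_, hc, ?_, ⟨_, hH⟩, ?_⟩
  · rw [integral_sub hint (integrable_const _)]
    simp [measureReal_def, UnitAddCircle.measure_univ]
  rintro g ⟨c₁, c₂, hcc, -, hg⟩ ⟨u, -, hu⟩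
  have hc2 : (c₂ : ℝ) ≤ 0.1 := by have := c₁.coe_nonneg; linarith
  obtain ⟨n, hn⟩ := ((b_tendsto D).eventually_gt_atTop (48 * ‖u‖)).exists
  have hq : (0 : ℝ) < Q n := by exact_mod_cast D.pos n
  have ha : 0 < (Q n : ℝ) ^ (-(ξ : ℝ)) := Real.rpow_pos_of_pos hq _
  set δ : ℝ := 1 / (2 * Q n) with hδ
  have hδ0 : 0 ≤ δ := by positivity
  have step : ∀ k : ℕ, (k : ℝ) ≤ Q n / 6 → 0.8 * (Q n : ℝ) ^ (-(ξ : ℝ)) ≤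
      g ((k * α : ℝ) : UnitAddCircle) - g ((k * α + δ : ℝ) : UnitAddCircle) := by
    intro k hk
    have h1 := F_diff D n k hk
    have h2 := hg.dist_le ((k * α : ℝ) : UnitAddCircle) ((k * α + δ : ℝ) : UnitAddCircle)
    have hdist : dist ((k * α : ℝ) : UnitAddCircle)
        ((k * α + δ : ℝ) : UnitAddCircle) ≤ δ := by
      rw [dist_comm, dist_eq_norm, ← AddCircle.coe_sub, add_sub_cancel_left]
      refine (UnitAddCircle.norm_eq).trans_le ?_
      refine (round_le _ 0).trans (le_of_eq ?_)
      simp [abs_of_nonneg hδ0]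
    have h3 : dist ((k * α : ℝ) : UnitAddCircle)
        ((k * α + δ : ℝ) : UnitAddCircle) ^ (ξ : ℝ) ≤ (Q n : ℝ) ^ (-(ξ : ℝ)) := by
      calc _ ≤ (1 / (Q n : ℝ)) ^ (ξ : ℝ) := by
            refine Real.rpow_le_rpow dist_nonneg (hdist.trans ?_) h0.le
            exact one_div_le_one_div_of_le hq (by linarith)
        _ = _ := by rw [one_div, Real.inv_rpow hq.le, Real.rpow_neg hq.le]
    have h4 := h2.trans (mul_le_mul hc2 h3 (by positivity) (by norm_num))
    rw [Real.dist_eq] at h4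
    have h5 := (abs_le.mp h4).1
    simp only [Pi.sub_apply] at h5
    linarith
  have tele : ∀ (s : ℝ) (N : ℕ), ∑ k ∈ Finset.range N, g ((k * α + s : ℝ) : UnitAddCircle)
      = u ((N * α + s : ℝ) : UnitAddCircle) - u ((s : ℝ) : UnitAddCircle) := by
    intro s N
    induction N with
    | zero => simp
    | succ N ih =>
      rw [Finset.sum_range_succ, ih, hu, ← AddCircle.coe_add]
      have : (N : ℝ) * α + s + α = ((N + 1 : ℕ) : ℝ) * α + s := by push_cast; ring
      rw [this]; ring
  set N := ⌊(Q n : ℝ) / 6⌋₊ + 1 with hN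
  have hN1 : (Q n : ℝ) / 6 ≤ N := by
    rw [hN]; push_cast; exact (Nat.lt_floor_add_one _).le
  have hsum : (N : ℝ) * (0.8 * (Q n : ℝ) ^ (-(ξ : ℝ))) ≤
      ∑ k ∈ Finset.range N, (g ((k * α + 0 : ℝ) : UnitAddCircle)
        - g ((k * α + δ : ℝ) : UnitAddCircle)) := by
    have := Finset.card_nsmul_le_sum (Finset.range N)
      (fun k : ℕ => g ((k * α + 0 : ℝ) : UnitAddCircle)
        - g ((k * α + δ : ℝ) : UnitAddCircle)) (0.8 * (Q n : ℝ) ^ (-(ξ : ℝ))) (by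
        intro k hk
        rw [add_zero]
        apply step
        have : k ≤ ⌊(Q n : ℝ) / 6⌋₊ := by
          have := Finset.mem_range.mp hk
          omega
        exact (Nat.le_floor_iff (by positivity)).mp this)
    simpa using this
  rw [Finset.sum_sub_distrib, tele, tele] at hsum
  have hb : ∀ z, |u z| ≤ ‖u‖ := fun z => u.norm_coe_le_norm z
  have b1 := abs_le.mp (hb ((N * α + 0 : ℝ) : UnitAddCircle))
  have b2 := abs_le.mp (hb ((0 : ℝ) : UnitAddCircle))
  have b3 := abs_le.mp (hb ((N * α + δ : ℝ) : UnitAddCircle))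
  have b4 := abs_le.mp (hb ((δ : ℝ) : UnitAddCircle))
  have hlow : (Q n : ℝ) ^ (1 - (ξ : ℝ)) * (0.8 / 6) ≤
      (N : ℝ) * (0.8 * (Q n : ℝ) ^ (-(ξ : ℝ))) := by
    calc _ = (Q n : ℝ) / 6 * (0.8 * (Q n : ℝ) ^ (-(ξ : ℝ))) := by
          rw [sub_eq_add_neg, Real.rpow_add hq, Real.rpow_one]; ring
      _ ≤ _ := by gcongr
  have := norm_nonneg u
  linarith
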